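/- arXiv:2202.04439 — 6 statements merged into one kernel-verified Lean document; each statement's English description precedes it below -/
import Mathlib

section
/- Let k be a real number and let I = {τ ∈ ℝ : 1 − kτ² > 0}. Then the function a(τ) = √(1 − kτ²) is twice differentiable on I, satisfies a(0) = 1 and a'(0) = 0, and satisfies a(τ)·a''(τ) + a'(τ)² + k = 0 for every τ ∈ I (equivalently, since a > 0, the FLRW Ricci scalar 6((a'² + k)/a² + a''/a) vanishes on I). -/
theorem hasDerivAt_sqrt_one_sub_mul_sq {k τ : ℝ} (hτ : 0 < 1 - k * τ ^ 2) :
    HasDerivAt (fun t : ℝ => √(1 - k * t ^ 2)) (-(k * τ) / √(1 - k * τ ^ 2)) τ := by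
  have h : HasDerivAt (fun t : ℝ => 1 - k * t ^ 2) (-(k * (2 * τ))) τ := by
    simpa using ((hasDerivAt_pow 2 τ).const_mul k).const_sub 1
  convert h.sqrt hτ.ne' using 1
  field_simp

theorem hasDerivAt_deriv_sqrt_one_sub_mul_sq {k τ : ℝ} (hτ : 0 < 1 - k * τ ^ 2) :
    HasDerivAt (deriv fun t : ℝ => √(1 - k * t ^ 2)) (-k / √(1 - k * τ ^ 2) ^ 3) τ := by
  have hpos : 0 < √(1 - k * τ ^ 2) := Real.sqrt_pos.2 hτ
  have hsq : √(1 - k * τ ^ 2) ^ 2 = 1 - k * τ ^ 2 := Real.sq_sqrt hτ.le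
  have hev : (deriv fun t : ℝ => √(1 - k * t ^ 2)) =ᶠ[nhds τ]
      fun t => -(k * t) / √(1 - k * t ^ 2) := by
    have hcont : Continuous fun t : ℝ => 1 - k * t ^ 2 := by fun_prop
    filter_upwards [hcont.continuousAt.eventually (lt_mem_nhds hτ)] with t ht
    exact (hasDerivAt_sqrt_one_sub_mul_sq ht).deriv
  refine HasDerivAt.congr_of_eventuallyEq ?_ hev
  have hnum : HasDerivAt (fun t : ℝ => -(k * t)) (-k) τ := by
    simpa using ((hasDerivAt_id' τ).const_mul k).fun_neg
  refine (hnum.fun_div (hasDerivAt_sqrt_one_sub_mul_sq hτ) hpos.ne').congr_deriv ?_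
  generalize √(1 - k * τ ^ 2) = s at *
  field_simp
  linear_combination -k * hsq

/-- For `a(τ) = √(1 - k τ²)` on `I = {τ | 1 - k τ² > 0}`: `a` is twice differentiable
on `I`, satisfies `a 0 = 1`, `a' 0 = 0`, and `a·a'' + a'² + k = 0` on `I`. -/
theorem stmt0 (k : ℝ) (a : ℝ → ℝ)
    (ha : ∀ τ : ℝ, a τ = Real.sqrt (1 - k * τ ^ 2)) :
    (∀ τ : ℝ, 1 - k * τ ^ 2 > 0 →
      DifferentiableAt ℝ a τ ∧ DifferentiableAt ℝ (deriv a) τ) ∧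
    a 0 = 1 ∧ deriv a 0 = 0 ∧
    (∀ τ : ℝ, 1 - k * τ ^ 2 > 0 →
      a τ * deriv (deriv a) τ + (deriv a τ) ^ 2 + k = 0) := by
  obtain rfl : a = fun τ => √(1 - k * τ ^ 2) := funext ha
  refine ⟨fun τ hτ => ⟨(hasDerivAt_sqrt_one_sub_mul_sq hτ).differentiableAt,
    (hasDerivAt_deriv_sqrt_one_sub_mul_sq hτ).differentiableAt⟩, by simp, ?_, fun τ hτ => ?_⟩
  · rw [(hasDerivAt_sqrt_one_sub_mul_sq (by norm_num)).deriv]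
    simp
  · rw [(hasDerivAt_deriv_sqrt_one_sub_mul_sq hτ).deriv, (hasDerivAt_sqrt_one_sub_mul_sq hτ).deriv]
    have hpos : 0 < √(1 - k * τ ^ 2) := Real.sqrt_pos.2 hτ
    have hsq : √(1 - k * τ ^ 2) ^ 2 = 1 - k * τ ^ 2 := Real.sq_sqrt hτ.le
    dsimp only
    generalize √(1 - k * τ ^ 2) = s at *
    field_simp
    linear_combination k * hsq
end

section
/- Let k ∈ ℝ and let I ⊆ ℝ be an interval containing 0. Suppose a : I → ℝ is twice differentiable with a(τ) > 0 for all τ ∈ I, a(0) = 1, a'(0) = 0, and a(τ)·a''(τ) + a'(τ)² + k = 0 for all τ ∈ I. Then 1 − kτ² > 0 and a(τ) = √(1 − kτ²) for every τ ∈ I. -/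
theorem Convex.eq_of_hasDerivAt_zero {s : Set ℝ} (hs : Convex ℝ s) {f : ℝ → ℝ}
    (hf : ∀ x ∈ s, HasDerivAt f 0 x) {x y : ℝ} (hx : x ∈ s) (hy : y ∈ s) : f y = f x := by
  have h := hs.norm_image_sub_le_of_norm_hasDerivWithin_le (C := 0)
    (fun z hz => (hf z hz).hasDerivWithinAt) (by simp) hx hy
  rw [zero_mul, norm_le_zero_iff] at h
  exact sub_eq_zero.mp h

/-- If `a` is twice differentiable on an interval `I ∋ 0`, positive, with `a 0 = 1`,
`a' 0 = 0` and `a·a'' + a'² + k = 0` on `I`, then `1 - k τ² > 0` and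
`a τ = √(1 - k τ²)` on `I`. -/
theorem stmt1 (k : ℝ) (I : Set ℝ) (hI : Convex ℝ I) (h0 : (0 : ℝ) ∈ I)
    (a a' a'' : ℝ → ℝ)
    (hda : ∀ τ ∈ I, HasDerivAt a (a' τ) τ)
    (hda' : ∀ τ ∈ I, HasDerivAt a' (a'' τ) τ)
    (hpos : ∀ τ ∈ I, 0 < a τ)
    (ha0 : a 0 = 1) (ha'0 : a' 0 = 0)
    (hode : ∀ τ ∈ I, a τ * a'' τ + (a' τ) ^ 2 + k = 0) :
    ∀ τ ∈ I, 1 - k * τ ^ 2 > 0 ∧ a τ = Real.sqrt (1 - k * τ ^ 2) := by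
  have first_integral : ∀ τ ∈ I, a τ * a' τ + k * τ = 0 := by
    intro τ hτ
    have h := hI.eq_of_hasDerivAt_zero (f := fun t => a t * a' t + k * t) (fun t ht =>
      (((hda t ht).mul (hda' t ht)).add ((hasDerivAt_id t).const_mul k)).congr_deriv
        (by linarith [hode t ht])) h0 hτ
    simpa [ha'0] using h
  have sq_eq : ∀ τ ∈ I, a τ ^ 2 = 1 - k * τ ^ 2 := by
    intro τ hτ
    have h := hI.eq_of_hasDerivAt_zero (f := fun t => a t ^ 2 + k * t ^ 2) (fun t ht =>
      (((hda t ht).pow 2).add (((hasDerivAt_id t).pow 2).const_mul k)).congr_deriv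
        (by simp; linarith [first_integral t ht])) h0 hτ
    simp only [ha0] at h
    linarith
  intro τ hτ
  rw [← sq_eq τ hτ]
  exact ⟨pow_pos (hpos τ hτ) 2, (Real.sqrt_sq (hpos τ hτ).le).symm⟩
end

section
/- Let I ⊆ ℝ be an interval and let a : I → ℝ be twice differentiable with a(τ) > 0 for all τ ∈ I. Let k, R₊, f₊, f_{R+}, c be real constants with f_{R+} ≠ 0 and c ≠ 0. Assume that for all τ ∈ I: (i) 6((a'(τ)² + k)/a(τ)² + a''(τ)/a(τ)) = R₊; (ii) a''(τ)/a(τ) = −2(a'(τ)² + k)/a(τ)² + f₊/(2 f_{R+}); and (iii) (a'(τ)² + k)/a(τ)² = (1/f_{R+})·(c/(6 a(τ)³) + f₊/6). Then 2f₊ − f_{R+}·R₊ ≠ 0 and a(τ)³ = c/(2f₊ − f_{R+}·R₊) for every τ ∈ I; in particular, a is constant on I. -/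
/-- Algebraic core of Result 1: a dust FLRW interior satisfying the third junction
condition with a constant-curvature exterior together with the constant-curvature
f(R) equations of motion must have constant scale factor
`a³ = c / (2 f₊ - f_{R+} R₊)`. -/
theorem stmt2 (I : Set ℝ) (hI : Convex ℝ I) (hne : I.Nonempty)
    (a a' a'' : ℝ → ℝ)
    (hda : ∀ τ ∈ I, HasDerivAt a (a' τ) τ)
    (hda' : ∀ τ ∈ I, HasDerivAt a' (a'' τ) τ)
    (hpos : ∀ τ ∈ I, 0 < a τ)
    (k Rp fp fRp c : ℝ) (hfRp : fRp ≠ 0) (hc : c ≠ 0)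
    (h1 : ∀ τ ∈ I, 6 * (((a' τ) ^ 2 + k) / (a τ) ^ 2 + a'' τ / a τ) = Rp)
    (h2 : ∀ τ ∈ I,
      a'' τ / a τ = -2 * ((a' τ) ^ 2 + k) / (a τ) ^ 2 + fp / (2 * fRp))
    (h3 : ∀ τ ∈ I, ((a' τ) ^ 2 + k) / (a τ) ^ 2
      = (1 / fRp) * (c / (6 * (a τ) ^ 3) + fp / 6)) :
    2 * fp - fRp * Rp ≠ 0 ∧
    (∀ τ ∈ I, (a τ) ^ 3 = c / (2 * fp - fRp * Rp)) ∧
    ∀ τ₁ ∈ I, ∀ τ₂ ∈ I, a τ₁ = a τ₂ := by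
  have key : ∀ τ ∈ I, c = (2 * fp - fRp * Rp) * a τ ^ 3 := by
    intro τ hτ
    have ha : a τ ≠ 0 := (hpos τ hτ).ne'
    have e1 := h1 τ hτ
    have e2 := h2 τ hτ
    rw [e2, mul_div_assoc, h3 τ hτ] at e1
    rw [← e1]
    field_simp
    ring
  have hD : 2 * fp - fRp * Rp ≠ 0 := by
    obtain ⟨τ, hτ⟩ := hne
    intro h
    apply hc
    rw [key τ hτ, h, zero_mul]
  have hcube : ∀ τ ∈ I, a τ ^ 3 = c / (2 * fp - fRp * Rp) := fun τ hτ => by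
    rw [eq_div_iff hD, mul_comm, ← key τ hτ]
  refine ⟨hD, hcube, fun τ₁ h₁ τ₂ h₂ => ?_⟩
  exact (pow_left_inj₀ (hpos τ₁ h₁).le (hpos τ₂ h₂).le three_ne_zero).mp
    ((hcube τ₁ h₁).trans (hcube τ₂ h₂).symm)
end

section
/- Let A : ℝ × (0,∞) → (0,∞) be continuously differentiable, let β₀ ∈ ℝ, and let t_*, r_* : I → ℝ be differentiable on an interval I with r_*(τ) > 0. Write A_*(τ) = A(t_*(τ), r_*(τ)) and A_{t*}(τ) = ∂_t A(t_*(τ), r_*(τ)), and define β(τ) = A_*(τ)·ṫ_*(τ). Assume for all τ ∈ I: β(τ)² = A_*(τ) + ṙ_*(τ)², β(τ) = β₀, and 0 = (1/2)·(A_{t*}(τ)·ṫ_*(τ)² + (A_{t*}(τ)/A_*(τ)²)·ṙ_*(τ)²). Then A_{t*}(τ)·(2β₀² − A_*(τ)) = 0 for all τ ∈ I, and at every τ ∈ I with ṙ_*(τ) ≠ 0 one has A_{t*}(τ) = 0. -/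
/-- Clearing the denominator in `0 = ½ (d u² + (d / a²) v²)`. -/
theorem mul_sq_add_sq_eq_zero_of_half {a d u v : ℝ} (ha : a ≠ 0)
    (h : 0 = (1 / 2) * (d * u ^ 2 + (d / a ^ 2) * v ^ 2)) :
    d * ((a * u) ^ 2 + v ^ 2) = 0 := by
  field_simp at h
  linear_combination -h

/-- Core of Result 3: for `B = 1/A`, the junction conditions
`β² = A_* + ṙ_*²`, `β = β₀` and `0 = ½(A_{t*} ṫ_*² + (A_{t*}/A_*²) ṙ_*²)` imply
`A_{t*}(2β₀² - A_*) = 0`, and wherever `ṙ_* ≠ 0` one has `A_{t*} = 0`. -/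
theorem stmt9 (A : ℝ × ℝ → ℝ) (hA : ContDiff ℝ 1 A)
    (hApos : ∀ p : ℝ × ℝ, 0 < p.2 → 0 < A p)
    (β₀ : ℝ) (I : Set ℝ) (hI : Convex ℝ I)
    (ts rs ts' rs' : ℝ → ℝ)
    (hts : ∀ τ ∈ I, HasDerivAt ts (ts' τ) τ)
    (hrs : ∀ τ ∈ I, HasDerivAt rs (rs' τ) τ)
    (hrpos : ∀ τ ∈ I, 0 < rs τ)
    (hβ : ∀ τ ∈ I, (A (ts τ, rs τ) * ts' τ) ^ 2 = A (ts τ, rs τ) + (rs' τ) ^ 2)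
    (hβ0 : ∀ τ ∈ I, A (ts τ, rs τ) * ts' τ = β₀)
    (hdot : ∀ τ ∈ I, 0 = (1 / 2) *
      (fderiv ℝ A (ts τ, rs τ) ((1:ℝ), (0:ℝ)) * (ts' τ) ^ 2
        + (fderiv ℝ A (ts τ, rs τ) ((1:ℝ), (0:ℝ)) / (A (ts τ, rs τ)) ^ 2)
          * (rs' τ) ^ 2)) :
    (∀ τ ∈ I, fderiv ℝ A (ts τ, rs τ) ((1:ℝ), (0:ℝ))
      * (2 * β₀ ^ 2 - A (ts τ, rs τ)) = 0) ∧
    ∀ τ ∈ I, rs' τ ≠ 0 → fderiv ℝ A (ts τ, rs τ) ((1:ℝ), (0:ℝ)) = 0 := by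
  have key : ∀ τ ∈ I, fderiv ℝ A (ts τ, rs τ) ((1:ℝ), (0:ℝ))
      * ((A (ts τ, rs τ) * ts' τ) ^ 2 + (rs' τ) ^ 2) = 0 := fun τ hτ =>
    mul_sq_add_sq_eq_zero_of_half (hApos _ (hrpos τ hτ)).ne' (hdot τ hτ)
  refine ⟨fun τ hτ => ?_, fun τ hτ hr => ?_⟩
  · have hsum : 2 * β₀ ^ 2 - A (ts τ, rs τ)
        = (A (ts τ, rs τ) * ts' τ) ^ 2 + (rs' τ) ^ 2 := by
      rw [← hβ0 τ hτ]
      linear_combination hβ τ hτ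
    rw [hsum]
    exact key τ hτ
  · have hpos : 0 < (A (ts τ, rs τ) * ts' τ) ^ 2 + (rs' τ) ^ 2 := by positivity
    exact (mul_eq_zero.mp (key τ hτ)).resolve_right hpos.ne'
end

section
/- Let β₀ ∈ ℝ with β₀² ≥ 8/9 and β₀ ≠ 0, and set Δ = √(9 − 8/β₀²). Let C, D ∈ ℝ with D ≠ 0 and define A(r) = D·r^{−(Δ+1)}·(C + r^Δ)² for r > 0 (real powers). Then at every r > 0 with C + r^Δ ≠ 0, the function A is twice differentiable and satisfies β₀²·(A''(r)·A(r) − A'(r)²/2 + 2·A'(r)·A(r)/r) = −(4(1 − β₀²)/r²)·A(r)². In particular, for β₀² = 1 (so Δ = 1) and D = 1, the function A(r) = (1 + C/r)² satisfies A''·A − A'²/2 + 2·A'·A/r = 0 for all r > 0 with r ≠ −C. -/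
/-- If `u` solves the Euler equation `u'' + 2u'/r = k u / r²` on `r > 0`, then `A = D u²` solves
`A''A - A'²/2 + 2A'A/r = 2k A²/r²` there. -/
theorem ode_of_eq_mul_sq {A u u' u'' : ℝ → ℝ} {D k : ℝ}
    (hA : ∀ r > (0 : ℝ), A r = D * u r ^ 2)
    (hu : ∀ r > (0 : ℝ), HasDerivAt u (u' r) r)
    (hu' : ∀ r > (0 : ℝ), HasDerivAt u' (u'' r) r)
    (hode : ∀ r > (0 : ℝ), u'' r + 2 * u' r / r = k * u r / r ^ 2) {r : ℝ} (hr : 0 < r) :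
    DifferentiableAt ℝ A r ∧ DifferentiableAt ℝ (deriv A) r ∧
      deriv (deriv A) r * A r - (deriv A r) ^ 2 / 2 + 2 * deriv A r * A r / r
        = 2 * k * (A r) ^ 2 / r ^ 2 := by
  have hA' : ∀ x > (0 : ℝ), HasDerivAt A (D * (2 * u x * u' x)) x := fun x hx => by
    have h := ((hu x hx).pow 2).const_mul D
    refine HasDerivAt.congr_of_eventuallyEq (h.congr_deriv (by norm_num)) ?_
    filter_upwards [lt_mem_nhds hx] with y hy using hA y hy
  have hA'' : HasDerivAt (deriv A) (D * (2 * (u' r * u' r + u r * u'' r))) r := by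
    have h := (((hu r hr).mul (hu' r hr)).const_mul 2).const_mul D
    refine h.congr_of_eventuallyEq ?_
    filter_upwards [lt_mem_nhds hr] with y hy
    rw [(hA' y hy).deriv, Pi.mul_apply]
    ring
  refine ⟨(hA' r hr).differentiableAt, hA''.differentiableAt, ?_⟩
  rw [hA''.deriv, (hA' r hr).deriv, hA r hr]
  linear_combination 2 * D ^ 2 * u r ^ 3 * hode r hr

/-- The power `u = r^a` solves the Euler equation `u'' + 2u'/r = k u / r²` when
`a² + a = k`. -/
theorem euler_rpow {a k r : ℝ} (ha : a ^ 2 + a = k) (hr : 0 < r) :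
    a * ((a - 1) * r ^ (a - 1 - 1)) + 2 * (a * r ^ (a - 1)) / r = k * r ^ a / r ^ 2 := by
  rw [Real.rpow_sub_one hr.ne', Real.rpow_sub_one hr.ne', ← ha]
  field_simp
  ring

/-- The family `A(r) = D r^{-(Δ+1)} (C + r^Δ)²` with `Δ = √(9 - 8/β₀²)` solves the
third-junction-condition ODE
`β₀²(A''A - A'²/2 + 2A'A/r) = -(4(1-β₀²)/r²) A²`; in particular, for `β₀² = 1`
(so `Δ = 1`) and `D = 1`, `A(r) = (1 + C/r)²` solves
`A''A - A'²/2 + 2A'A/r = 0`. -/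
theorem stmt14 (β₀ C D Δ : ℝ) (hβ : β₀ ^ 2 ≥ 8 / 9) (hβ₀ : β₀ ≠ 0) (hD : D ≠ 0)
    (hΔ : Δ = Real.sqrt (9 - 8 / β₀ ^ 2))
    (A : ℝ → ℝ)
    (hA : ∀ r > (0:ℝ), A r = D * r ^ (-(Δ + 1)) * (C + r ^ Δ) ^ 2) :
    (∀ r > (0:ℝ), C + r ^ Δ ≠ 0 →
      DifferentiableAt ℝ A r ∧ DifferentiableAt ℝ (deriv A) r ∧
      β₀ ^ 2 * (deriv (deriv A) r * A r - (deriv A r) ^ 2 / 2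
          + 2 * deriv A r * A r / r)
        = -(4 * (1 - β₀ ^ 2) / r ^ 2) * (A r) ^ 2) ∧
    (∀ A₂ : ℝ → ℝ, (∀ r > (0:ℝ), A₂ r = (1 + C / r) ^ 2) →
      β₀ ^ 2 = 1 → D = 1 →
      ∀ r > (0:ℝ), r ≠ -C →
        DifferentiableAt ℝ A₂ r ∧ DifferentiableAt ℝ (deriv A₂) r ∧
        deriv (deriv A₂) r * A₂ r - (deriv A₂ r) ^ 2 / 2
          + 2 * deriv A₂ r * A₂ r / r = 0) := by
  constructor
  · intro r hr _
    have hβpos : 0 < β₀ ^ 2 := by positivity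
    have hΔsq : Δ ^ 2 = 9 - 8 / β₀ ^ 2 := by
      rw [hΔ, Real.sq_sqrt]
      rw [sub_nonneg, div_le_iff₀ hβpos]
      linarith
    set a := -(Δ + 1) / 2 with ha
    set b := (Δ - 1) / 2 with hb
    have hak : a ^ 2 + a = 2 - 2 / β₀ ^ 2 := by
      rw [ha]
      linear_combination hΔsq / 4
    have hbk : b ^ 2 + b = 2 - 2 / β₀ ^ 2 := by
      rw [hb]
      linear_combination hΔsq / 4
    have hpow : ∀ s x : ℝ, 0 < x → HasDerivAt (fun y : ℝ => y ^ s) (s * x ^ (s - 1)) x :=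
      fun s x hx => Real.hasDerivAt_rpow_const (Or.inl hx.ne')
    obtain ⟨h₁, h₂, h₃⟩ := ode_of_eq_mul_sq (A := A) (D := D) (k := 2 - 2 / β₀ ^ 2)
      (u := fun x => C * x ^ a + x ^ b)
      (u' := fun x => C * (a * x ^ (a - 1)) + b * x ^ (b - 1))
      (u'' := fun x => C * (a * ((a - 1) * x ^ (a - 1 - 1))) + b * ((b - 1) * x ^ (b - 1 - 1)))
      (fun x hx => by
        have hb' : x ^ b = x ^ a * x ^ Δ := by
          rw [← Real.rpow_add hx]
          congr 1
          rw [ha, hb]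
          ring
        have ha' : x ^ (-(Δ + 1)) = x ^ a * x ^ a := by
          rw [← Real.rpow_add hx]
          congr 1
          rw [ha]
          ring
        rw [hA x hx, hb', ha']
        ring)
      (fun x hx => ((hpow a x hx).const_mul C).add (hpow b x hx))
      (fun x hx => (((hpow (a - 1) x hx).const_mul a).const_mul C).add
        ((hpow (b - 1) x hx).const_mul b))
      (fun x hx => by
        linear_combination C * euler_rpow hak hx + euler_rpow hbk hx)
      hr
    refine ⟨h₁, h₂, ?_⟩
    rw [h₃]
    field_simp
    ring
  · intro A₂ hA₂ _ _ r hr _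
    have hinv : ∀ x > (0 : ℝ), HasDerivAt (fun y : ℝ => 1 + C / y) (-C / x ^ 2) x :=
      fun x hx => by
        have h := ((hasDerivAt_inv hx.ne').const_mul C).const_add 1
        simp only [← div_eq_mul_inv] at h
        exact h.congr_deriv (by ring)
    have hinv' : ∀ x > (0 : ℝ), HasDerivAt (fun y : ℝ => -C / y ^ 2) (2 * C / x ^ 3) x :=
      fun x hx => by
        have h := (hasDerivAt_const x (-C)).div (hasDerivAt_pow 2 x) (pow_ne_zero 2 hx.ne')
        refine h.congr_deriv ?_
        field_simp
        norm_num
        ring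
    have h := ode_of_eq_mul_sq (A := A₂) (D := 1) (k := 0) (fun x hx => by rw [hA₂ x hx, one_mul])
      hinv hinv' (fun x hx => by field_simp; ring) hr
    simpa using h
end

section
/- Let β₀ ∈ ℝ with β₀² > 8/9, and set Δ = √(9 − 8/β₀²) (so Δ > 0). Let A : (0,∞) → ℝ be twice continuously differentiable with A(r) > 0 for all r > 0, and suppose that β₀²·(A''(r)·A(r) − A'(r)²/2 + 2·A'(r)·A(r)/r) = −(4(1 − β₀²)/r²)·A(r)² for all r > 0. Then there exist c₁, c₂ ∈ ℝ, not both zero, such that A(r) = r^{−(Δ+1)}·(c₁ + c₂·r^Δ)² for all r > 0 (real powers). -/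
/-- First integral of the Euler equation `r² u'' + 2 r u' + p q u = 0` with indicial roots
`p`, `q` satisfying `p + q = -1`. -/
theorem euler_first_integral {u v w : ℝ → ℝ} {p q : ℝ} (hpq : p + q = -1)
    (hu : ∀ r > (0:ℝ), HasDerivAt u (v r) r) (hv : ∀ r > (0:ℝ), HasDerivAt v (w r) r)
    (h : ∀ r > (0:ℝ), r ^ 2 * w r + 2 * r * v r + p * q * u r = 0) :
    ∃ c : ℝ, ∀ r > (0:ℝ), r * v r - q * u r = c * r ^ p := by
  have hd : ∀ r > (0:ℝ), HasDerivAt (fun r => r ^ (-p) * (r * v r - q * u r)) 0 r := by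
    intro r hr
    have h1 := (Real.hasDerivAt_rpow_const (p := -p) (Or.inl hr.ne')).mul
      (((hasDerivAt_id r).mul (hv r hr)).sub ((hu r hr).const_mul q))
    refine h1.congr_deriv ?_
    have hp : r ^ (-p) = r ^ (-p - 1) * r := by
      rw [← Real.rpow_add_one hr.ne']; ring_nf
    simp only [id, Pi.mul_apply, Pi.sub_apply, hp]
    have hq : q = -1 - p := by linarith
    have := h r hr
    subst hq
    linear_combination r ^ (-p - 1) * this
  have hc : ∀ r > (0:ℝ), r ^ (-p) * (r * v r - q * u r) =
      (1:ℝ) ^ (-p) * (1 * v 1 - q * u 1) := by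
    intro r hr
    exact isOpen_Ioi.is_const_of_deriv_eq_zero (s := Set.Ioi (0:ℝ)) isPreconnected_Ioi
      (fun x hx => (hd x hx).differentiableAt.differentiableWithinAt)
      (fun x hx => (hd x hx).deriv) hr (Set.mem_Ioi.2 one_pos)
  refine ⟨(1:ℝ) ^ (-p) * (1 * v 1 - q * u 1), fun r hr => ?_⟩
  rw [← hc r hr, mul_right_comm, ← Real.rpow_add hr]
  simp

/-- Solutions of the Euler equation with distinct indicial roots are combinations of powers. -/
theorem euler_solution {u v w : ℝ → ℝ} {p q : ℝ} (hpq : p + q = -1) (hne : p ≠ q)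
    (hu : ∀ r > (0:ℝ), HasDerivAt u (v r) r) (hv : ∀ r > (0:ℝ), HasDerivAt v (w r) r)
    (h : ∀ r > (0:ℝ), r ^ 2 * w r + 2 * r * v r + p * q * u r = 0) :
    ∃ a b : ℝ, ∀ r > (0:ℝ), u r = a * r ^ p + b * r ^ q := by
  obtain ⟨a, ha⟩ := euler_first_integral hpq hu hv h
  obtain ⟨b, hb⟩ := euler_first_integral (p := q) (q := p) (by linarith) hu hv
    (fun r hr => by rw [mul_comm q p]; exact h r hr)
  have hne' : p - q ≠ 0 := sub_ne_zero.2 hne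
  refine ⟨a / (p - q), -b / (p - q), fun r hr => ?_⟩
  field_simp
  linear_combination ha r hr - hb r hr

/-- Classification of the positive solutions of the third-junction-condition ODE
`β₀²(A''A - A'²/2 + 2A'A/r) = -(4(1-β₀²)/r²) A²` on `(0,∞)` for `β₀² > 8/9`:
every twice continuously differentiable positive solution is of the form
`A(r) = r^{-(Δ+1)} (c₁ + c₂ r^Δ)²` with `(c₁, c₂) ≠ (0,0)`. -/
theorem stmt15 (β₀ Δ : ℝ) (hβ : β₀ ^ 2 > 8 / 9)
    (hΔ : Δ = Real.sqrt (9 - 8 / β₀ ^ 2))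
    (A : ℝ → ℝ) (hA : ∀ r > (0:ℝ), ContDiffAt ℝ 2 A r)
    (hApos : ∀ r > (0:ℝ), 0 < A r)
    (hode : ∀ r > (0:ℝ),
      β₀ ^ 2 * (deriv (deriv A) r * A r - (deriv A r) ^ 2 / 2
          + 2 * deriv A r * A r / r)
        = -(4 * (1 - β₀ ^ 2) / r ^ 2) * (A r) ^ 2) :
    ∃ c₁ c₂ : ℝ, ¬(c₁ = 0 ∧ c₂ = 0) ∧
      ∀ r > (0:ℝ), A r = r ^ (-(Δ + 1)) * (c₁ + c₂ * r ^ Δ) ^ 2 := by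
  have hβ0 : β₀ ≠ 0 := by
    rintro rfl
    norm_num at hβ
  have hβpos : 0 < β₀ ^ 2 := by linarith
  have hpos : 0 < 9 - 8 / β₀ ^ 2 := by
    rw [sub_pos, div_lt_iff₀ hβpos]; linarith
  have hΔpos : 0 < Δ := hΔ ▸ Real.sqrt_pos.2 hpos
  have hΔsq : Δ ^ 2 = 9 - 8 / β₀ ^ 2 := by rw [hΔ, Real.sq_sqrt hpos.le]
  have hA1 : ∀ r > (0:ℝ), HasDerivAt A (deriv A r) r := fun r hr =>
    ((hA r hr).differentiableAt (by norm_num)).hasDerivAt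
  have hA2 : ∀ r > (0:ℝ), HasDerivAt (deriv A) (deriv (deriv A) r) r := fun r hr =>
    ((((hA r hr).fderiv_right (m := 1) (by norm_num)).clm_apply
      (contDiffAt_const (c := (1:ℝ)))).differentiableAt (by norm_num)).hasDerivAt
  have hs : ∀ r > (0:ℝ), √(A r) ≠ 0 := fun r hr => (Real.sqrt_pos.2 (hApos r hr)).ne'
  have hu : ∀ r > (0:ℝ), HasDerivAt (fun r => √(A r)) (deriv A r / (2 * √(A r))) r :=
    fun r hr => (hA1 r hr).sqrt (hApos r hr).ne'
  have hv : ∀ r > (0:ℝ), HasDerivAt (fun r => deriv A r / (2 * √(A r)))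
      ((deriv (deriv A) r * (2 * √(A r)) - deriv A r * (2 * (deriv A r / (2 * √(A r)))))
        / (2 * √(A r)) ^ 2) r :=
    fun r hr => (hA2 r hr).div ((hu r hr).const_mul 2) (mul_ne_zero two_ne_zero (hs r hr))
  obtain ⟨a, b, hab⟩ := euler_solution (p := (-1 - Δ) / 2) (q := (-1 + Δ) / 2)
    (by ring) (by intro h; linarith) hu hv (by
      intro r hr
      have hode' := hode r hr
      have hsr := hs r hr
      have hsq : A r = √(A r) ^ 2 := (Real.sq_sqrt (hApos r hr).le).symm
      have hk : (-1 - Δ) / 2 * ((-1 + Δ) / 2) = 2 / β₀ ^ 2 - 2 := by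
        linear_combination -hΔsq / 4
      rw [hk]
      set s := √(A r)
      rw [hsq] at hode'
      have hr0 : r ≠ 0 := hr.ne'
      field_simp at hode' ⊢
      linear_combination hode')
  have hform : ∀ r > (0:ℝ), A r = r ^ (-(Δ + 1)) * (a + b * r ^ Δ) ^ 2 := by
    intro r hr
    have h1 : r ^ ((-1 + Δ) / 2) = r ^ ((-1 - Δ) / 2) * r ^ Δ := by
      rw [← Real.rpow_add hr]; ring_nf
    have h2 : r ^ (-(Δ + 1)) = r ^ ((-1 - Δ) / 2) * r ^ ((-1 - Δ) / 2) := by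
      rw [← Real.rpow_add hr]; ring_nf
    rw [← Real.sq_sqrt (hApos r hr).le, hab r hr, h1, h2]
    ring
  refine ⟨a, b, ?_, hform⟩
  rintro ⟨rfl, rfl⟩
  have := hform 1 one_pos
  have := hApos 1 one_pos
  simp_all
end
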